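/- arXiv:2509.25461 — 5 statements merged into one kernel-verified Lean document; each statement's English description precedes it below -/
import Mathlib

section
/- Let O be a regular local ring and let N be a finitely generated O-module such that Ext^i_O(N, O) = 0 for all i ≥ 1. Then N is a free O-module. -/
open CategoryTheory

/-- A Noetherian local ring is *regular* if its maximal ideal is generated by a
regular sequence whose length equals the Krull dimension of the ring. -/
def IsRegularLocal (O : Type) [CommRing O] [IsLocalRing O] : Prop :=
  ∃ rs : List O, RingTheory.Sequence.IsRegular O rs ∧
    Ideal.ofList rs = IsLocalRing.maximalIdeal O ∧
    (rs.length : WithBot (WithTop ℕ)) = ringKrullDim O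

open scoped Matrix

structure ExRes (R : Type) [CommRing R] (n : ℕ → ℕ)
    (A : ∀ i, Matrix (Fin (n i)) (Fin (n (i+1))) R) : Prop where
  zero : ∀ i, A i * A (i+1) = 0
  ex : ∀ i v, A i *ᵥ v = 0 → ∃ w, v = A (i+1) *ᵥ w
  dual : ∀ i v, v ᵥ* A (i+1) = 0 → ∃ w, v = w ᵥ* A i

section
variable {R : Type} [CommRing R] {n : ℕ → ℕ}
    {A : ∀ i, Matrix (Fin (n i)) (Fin (n (i+1))) R}

lemma ExRes.exM (h : ExRes R n A) (i : ℕ) {k : ℕ} (V : Matrix (Fin (n (i+1))) (Fin k) R)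
    (hV : A i * V = 0) : ∃ W : Matrix _ _ R, V = A (i+1) * W := by
  have (j : Fin k) : ∃ w, V.col j = A (i+1) *ᵥ w := by
    apply h.ex
    ext a
    exact congrFun (congrFun hV a) j
  choose w hw using this
  refine ⟨Matrix.of fun a j => w j a, ?_⟩
  ext a j
  exact congrFun (hw j) a

lemma ExRes.dualM (h : ExRes R n A) (i : ℕ) {k : ℕ} (V : Matrix (Fin k) (Fin (n (i+1))) R)
    (hV : V * A (i+1) = 0) : ∃ W : Matrix _ _ R, V = W * A i := by
  have (j : Fin k) : ∃ w, V.row j = w ᵥ* A i := by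
    apply h.dual
    ext a
    exact congrFun (congrFun hV j) a
  choose w hw using this
  refine ⟨Matrix.of w, ?_⟩
  ext j a
  exact congrFun (hw j) a

lemma exists_mat_of_map_zero (x : R) {k l : ℕ} (V : Matrix (Fin k) (Fin l) R)
    (hV : V.map (Ideal.Quotient.mk (Ideal.span {x})) = 0) : ∃ C : Matrix _ _ R, V = x • C := by
  have this : ∀ i j, ∃ c, V i j = x * c := by
    intro i j
    have := congrFun (congrFun hV i) j
    simp only [Matrix.map_apply, Matrix.zero_apply, Ideal.Quotient.eq_zero_iff_mem,
      Ideal.mem_span_singleton] at this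
    exact this
  choose c hc using this
  exact ⟨Matrix.of c, by ext i j; simpa using hc i j⟩

lemma exists_vec_of_map_zero (x : R) {k : ℕ} (V : Fin k → R)
    (hV : (fun i => Ideal.Quotient.mk (Ideal.span {x}) (V i)) = 0) : ∃ C, V = x • C := by
  have this : ∀ i, ∃ c, V i = x * c := by
    intro i
    have := congrFun hV i
    simp only [Pi.zero_apply, Ideal.Quotient.eq_zero_iff_mem,
      Ideal.mem_span_singleton] at this
    exact this
  choose c hc using this
  exact ⟨c, by ext i; simpa using hc i⟩

lemma vec_cancel {x : R} (hx : IsSMulRegular R x) {k : ℕ} {v : Fin k → R} (h : x • v = 0) : v = 0 := by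
  ext i
  have := congrFun h i
  exact hx (by simpa using this)

lemma mat_cancel {x : R} (hx : IsSMulRegular R x) {k l : ℕ} {v : Matrix (Fin k) (Fin l) R}
    (h : x • v = 0) : v = 0 := by
  ext i j
  have := congrFun (congrFun h i) j
  exact hx (by simpa using this)

lemma ExRes.quot (h : ExRes R n A) {x : R} (hx : IsSMulRegular R x) :
    ExRes (R ⧸ Ideal.span {x}) (fun i => n (i+1))
      (fun i => (A (i+1)).map (Ideal.Quotient.mk (Ideal.span {x}))) where
  zero i := by rw [← Matrix.map_mul, h.zero]; simp
  ex i v hv := by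
    obtain ⟨v, rfl⟩ : ∃ u : Fin _ → R, v = Ideal.Quotient.mk (Ideal.span {x}) ∘ u := by
      choose u hu using fun j => Ideal.Quotient.mk_surjective (v j)
      exact ⟨u, funext fun j => (hu j).symm⟩
    obtain ⟨z, hz⟩ := exists_vec_of_map_zero x (A (i+1) *ᵥ v) (by
      rw [← hv]; ext j; rw [RingHom.map_mulVec])
    have hz0 : A i *ᵥ z = 0 := by
      apply vec_cancel hx
      rw [← Matrix.mulVec_smul, ← hz, Matrix.mulVec_mulVec, h.zero, Matrix.zero_mulVec]
    obtain ⟨w, hw⟩ := h.ex _ _ hz0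
    obtain ⟨y, hy⟩ := h.ex (i+1) (v - x • w) (by
      rw [Matrix.mulVec_sub, hz, hw, Matrix.mulVec_smul, sub_self])
    refine ⟨Ideal.Quotient.mk _ ∘ y, ?_⟩
    ext j
    rw [← RingHom.map_mulVec, ← hy]
    simp
  dual i v hv := by
    obtain ⟨v, rfl⟩ : ∃ u : Fin _ → R, v = Ideal.Quotient.mk (Ideal.span {x}) ∘ u := by
      choose u hu using fun j => Ideal.Quotient.mk_surjective (v j)
      exact ⟨u, funext fun j => (hu j).symm⟩
    obtain ⟨z, hz⟩ := exists_vec_of_map_zero x (v ᵥ* A (i+1+1)) (by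
      rw [← hv]; ext j; rw [RingHom.map_vecMul])
    have hz0 : z ᵥ* A (i+1+1+1) = 0 := by
      apply vec_cancel hx
      rw [← Matrix.smul_vecMul, ← hz, Matrix.vecMul_vecMul, h.zero, Matrix.vecMul_zero]
    obtain ⟨w, hw⟩ := h.dual _ _ hz0
    obtain ⟨y, hy⟩ := h.dual (i+1) (v - x • w) (by
      rw [Matrix.sub_vecMul, hz, hw, Matrix.smul_vecMul, sub_self])
    refine ⟨Ideal.Quotient.mk _ ∘ y, ?_⟩
    ext j
    rw [← RingHom.map_vecMul, ← hy]
    simp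

lemma isUnit_one_sub [IsLocalRing R] {x : R} (hx : x ∈ IsLocalRing.maximalIdeal R) {k : ℕ}
    (D : Matrix (Fin k) (Fin k) R) : IsUnit (1 - x • D) := by
  rw [Matrix.isUnit_iff_isUnit_det]
  apply IsUnit.of_map (IsLocalRing.residue R)
  rw [RingHom.map_det]
  have : (IsLocalRing.residue R).mapMatrix (1 - x • D) = 1 := by
    have h0 : IsLocalRing.residue R x = 0 := by simpa using hx
    rw [map_sub, map_one, sub_eq_self]
    ext i j
    simp [h0]
  rw [this]; simp

lemma step_aux [IsLocalRing R] {a b c d : ℕ} {A0 : Matrix (Fin a) (Fin b) R}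
    {A1 : Matrix (Fin b) (Fin c) R} {A2 : Matrix (Fin c) (Fin d) R}
    (z0 : A0 * A1 = 0) (z1 : A1 * A2 = 0)
    (ex : ∀ V : Matrix (Fin b) (Fin c) R, A0 * V = 0 → ∃ W : Matrix (Fin c) (Fin c) R, V = A1 * W)
    (dual1 : ∀ V : Matrix (Fin b) (Fin c) R, V * A2 = 0 →
      ∃ W : Matrix (Fin b) (Fin b) R, V = W * A1)
    (dual0 : ∀ V : Matrix (Fin b) (Fin b) R, V * A1 = 0 →
      ∃ W : Matrix (Fin b) (Fin a) R, V = W * A0)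
    {x : R} (hx : IsSMulRegular R x)
    (hm : x ∈ IsLocalRing.maximalIdeal R)
    (hB : ∃ B : Matrix (Fin c) (Fin b) (R ⧸ Ideal.span {x}),
      A1.map (Ideal.Quotient.mk (Ideal.span {x})) * B *
      A1.map (Ideal.Quotient.mk (Ideal.span {x})) =
      A1.map (Ideal.Quotient.mk (Ideal.span {x}))) :
    ∃ B : Matrix (Fin b) (Fin a) R, A0 * B * A0 = A0 := by
  obtain ⟨B, hB⟩ := hB
  obtain ⟨B, rfl⟩ : ∃ B' : Matrix _ _ R, B = B'.map (Ideal.Quotient.mk (Ideal.span {x})) := by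
    choose u hu using fun i j => Ideal.Quotient.mk_surjective (B i j)
    exact ⟨Matrix.of u, by ext i j; exact (hu i j).symm⟩
  obtain ⟨C, hC⟩ := exists_mat_of_map_zero x (A1 - A1 * B * A1) (by
    rw [Matrix.map_sub _ (map_sub _), Matrix.map_mul, Matrix.map_mul, hB, sub_self])
  obtain ⟨D, hD⟩ := ex C (by
    apply mat_cancel hx
    rw [← Matrix.mul_smul, ← hC, Matrix.mul_sub, Matrix.mul_assoc A1, ← Matrix.mul_assoc A0,
      z0]; simp)
  obtain ⟨P, hP⟩ := dual1 C (by
    apply mat_cancel hx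
    rw [← Matrix.smul_mul, ← hC, Matrix.sub_mul, Matrix.mul_assoc (A1 * B), z1]; simp)
  obtain ⟨E, hE1, hE2⟩ := isUnit_iff_exists.1 (isUnit_one_sub hm D)
  obtain ⟨G, hG1, hG2⟩ := isUnit_iff_exists.1 (isUnit_one_sub hm P)
  have e1 : A1 * (1 - x • D) = A1 * B * A1 := by
    rw [Matrix.mul_sub, Matrix.mul_one, Matrix.mul_smul, ← hD, ← hC]; abel
  have e2 : (1 - x • P) * A1 = A1 * B * A1 := by
    rw [Matrix.sub_mul, Matrix.one_mul, Matrix.smul_mul, ← hP, ← hC]; abel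
  have e3 : A1 * E = G * A1 := by
    calc A1 * E = (G * (1 - x • P)) * A1 * E := by rw [hG2, Matrix.one_mul]
      _ = G * ((1 - x • P) * A1) * E := by simp only [Matrix.mul_assoc]
      _ = G * (A1 * (1 - x • D)) * E := by rw [e1, e2]
      _ = G * A1 * ((1 - x • D) * E) := by simp only [Matrix.mul_assoc]
      _ = _ := by rw [hE1, Matrix.mul_one]
  have e4 : A1 = A1 * (B * G) * A1 := by
    calc A1 = A1 * ((1 - x • D) * E) := by rw [hE1, Matrix.mul_one]
      _ = A1 * B * A1 * E := by rw [← e1, Matrix.mul_assoc]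
      _ = A1 * B * (A1 * E) := by simp only [Matrix.mul_assoc]
      _ = _ := by rw [e3]; simp only [Matrix.mul_assoc]
  obtain ⟨Q, hQ⟩ := dual0 (1 - A1 * (B * G)) (by
    rw [Matrix.sub_mul, ← e4, Matrix.one_mul, sub_self])
  refine ⟨Q, ?_⟩
  rw [Matrix.mul_assoc, ← hQ, Matrix.mul_sub, ← Matrix.mul_assoc, z0]; simp
end

lemma field_case {K : Type} [Field K] {k l : ℕ} (A : Matrix (Fin k) (Fin l) K) :
    ∃ B : Matrix (Fin l) (Fin k) K, A * B * A = A := by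
  let f := Matrix.toLin' A
  obtain ⟨s, hs⟩ := f.rangeRestrict.exists_rightInverse_of_surjective f.range_rangeRestrict
  obtain ⟨p, hp⟩ := f.range.subtype.exists_leftInverse_of_injective (by simp)
  refine ⟨LinearMap.toMatrix' (s ∘ₗ p), ?_⟩
  apply Matrix.toLin'.injective
  rw [Matrix.toLin'_mul, Matrix.toLin'_mul, Matrix.toLin'_toMatrix']
  ext1 v
  ext1
  have h1 : p (f (Pi.single v 1)) = f.rangeRestrict (Pi.single v 1) :=
    LinearMap.congr_fun hp (f.rangeRestrict (Pi.single v 1))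
  have h2 : f (s (f.rangeRestrict (Pi.single v 1))) = f (Pi.single v 1) :=
    congrArg Subtype.val (LinearMap.congr_fun hs (f.rangeRestrict (Pi.single v 1)))
  change f (s (p (f (Pi.single v 1)))) = f (Pi.single v 1)
  rw [h1, h2]

lemma main_mat (m : ℕ) : ∀ (R : Type) [CommRing R] [IsLocalRing R] (rs : List R),
    rs.length = m → RingTheory.Sequence.IsWeaklyRegular R rs →
    Ideal.ofList rs = IsLocalRing.maximalIdeal R → ∀ (n : ℕ → ℕ)
    (A : ∀ i, Matrix (Fin (n i)) (Fin (n (i+1))) R), ExRes R n A →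
    ∃ B : Matrix (Fin (n 1)) (Fin (n 0)) R, A 0 * B * A 0 = A 0 := by
  induction m with
  | zero =>
    intro R _ _ rs hl hr hm n A h
    obtain rfl := List.length_eq_zero_iff.1 hl
    have : IsField R := by
      rw [IsLocalRing.isField_iff_maximalIdeal_eq, ← hm]; simp
    let _ := this.toField
    exact field_case (A 0)
  | succ m ih =>
    intro R _ _ rs hl hr hm n A h
    obtain ⟨x, rs, rfl⟩ := List.exists_cons_of_length_eq_add_one hl
    rw [RingTheory.Sequence.isWeaklyRegular_cons_iff'] at hr
    obtain ⟨hx, hr⟩ := hr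
    have hxm : x ∈ IsLocalRing.maximalIdeal R := by
      rw [← hm]; exact Ideal.subset_span (by simp)
    have hle : Ideal.span {x} ≤ IsLocalRing.maximalIdeal R := by
      rwa [Ideal.span_singleton_le_iff_mem]
    have : Nontrivial (R ⧸ Ideal.span {x}) := Ideal.Quotient.nontrivial_iff.2 (fun e => by
      rw [e, top_le_iff] at hle; exact IsLocalRing.maximalIdeal.isMaximal R |>.ne_top hle)
    have : IsLocalRing (R ⧸ Ideal.span {x}) :=
      .of_surjective' _ Ideal.Quotient.mk_surjective
    refine step_aux (h.zero 0) (h.zero 1) (h.exM 0) (h.dualM 1) (h.dualM 0) hx hxm (ih (R ⧸ Ideal.span {x}) (rs.map (Ideal.Quotient.mk (Ideal.span {x})))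
      (by simpa using hl) ?_ ?_ _ _ (h.quot hx))
    · have e : QuotSMulTop x R ≃ₗ[R] (R ⧸ Ideal.span {x}) :=
        Submodule.quotEquivOfEq _ _ (by
          rw [← Submodule.ideal_span_singleton_smul]; simp)
      have := RingTheory.Sequence.isWeaklyRegular_map_algebraMap_iff (R := R) (R ⧸ Ideal.span {x})
        (R ⧸ Ideal.span {x}) rs
      refine this.2 ?_
      rw [← e.isWeaklyRegular_congr]
      exact (RingTheory.Sequence.isWeaklyRegular_map_algebraMap_iff (R ⧸ Ideal.span {x}) _ rs).1 hr
    · rw [← Ideal.map_ofList]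
      rw [Ideal.ofList_cons] at hm
      have h1 := congrArg (Ideal.map (Ideal.Quotient.mk (Ideal.span {x}))) hm
      rw [Ideal.map_sup, Ideal.map_quotient_self, bot_sup_eq] at h1
      rw [h1]
      exact IsLocalRing.map_maximalIdeal_of_surjective _ Ideal.Quotient.mk_surjective

lemma exists_next {R : Type} [CommRing R] [IsNoetherianRing R] {M : Type} [AddCommGroup M]
    [Module R M] {b : ℕ} (f : (Fin b → R) →ₗ[R] M) :
    ∃ (c : ℕ) (A : Matrix (Fin b) (Fin c) R), ∀ v, f v = 0 ↔ ∃ w, v = A *ᵥ w := by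
  obtain ⟨c, g, hg⟩ := Module.Finite.exists_fin' R (LinearMap.ker f)
  refine ⟨c, LinearMap.toMatrix' ((LinearMap.ker f).subtype ∘ₗ g), fun v => ⟨fun hv => ?_, ?_⟩⟩
  · obtain ⟨w, hw⟩ := hg ⟨v, hv⟩
    refine ⟨w, ?_⟩
    rw [← Matrix.toLin'_apply, Matrix.toLin'_toMatrix']
    simp [hw]
  · rintro ⟨w, rfl⟩
    rw [← Matrix.toLin'_apply, Matrix.toLin'_toMatrix']
    exact (g w).2

structure FinRes (R : Type) [CommRing R] (N : Type) [AddCommGroup N] [Module R N] (n : ℕ → ℕ)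
    (A : ∀ i, Matrix (Fin (n i)) (Fin (n (i+1))) R) (f : (Fin (n 0) → R) →ₗ[R] N) : Prop where
  surj : Function.Surjective f
  ex0 : ∀ v, f v = 0 ↔ ∃ w, v = A 0 *ᵥ w
  ex : ∀ i v, A i *ᵥ v = 0 ↔ ∃ w, v = A (i+1) *ᵥ w

lemma exists_finRes (R : Type) [CommRing R] [IsNoetherianRing R] (N : Type) [AddCommGroup N]
    [Module R N] [Module.Finite R N] : ∃ n A f, FinRes R N n A f := by
  obtain ⟨b, f, hf⟩ := Module.Finite.exists_fin' R N
  obtain ⟨c, A, hA⟩ := exists_next f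
  choose nx nA hnA using fun (s : Σ a b : ℕ, Matrix (Fin a) (Fin b) R) =>
    exists_next s.2.2.mulVecLin
  let s : ℕ → Σ a b : ℕ, Matrix (Fin a) (Fin b) R :=
    fun i => Nat.rec ⟨b, c, A⟩ (fun _ s => ⟨s.2.1, nx s, nA s⟩) i
  exact ⟨fun i => (s i).1, fun i => (s i).2.2, f, hf, hA, fun i v => hnA (s i) v⟩

section
variable {R : Type} [CommRing R] {N : Type} [AddCommGroup N] [Module R N] {n : ℕ → ℕ}
    {A : ∀ i, Matrix (Fin (n i)) (Fin (n (i+1))) R} {f : (Fin (n 0) → R) →ₗ[R] N}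

lemma FinRes.zero (h : FinRes R N n A f) (i : ℕ) : A i * A (i+1) = 0 := by
  apply Matrix.toLin'.injective
  apply LinearMap.ext
  intro v
  rw [Matrix.toLin'_mul, LinearMap.comp_apply, Matrix.toLin'_apply, Matrix.toLin'_apply,
    (h.ex i _).2 ⟨v, rfl⟩]
  simp

lemma FinRes.comp_zero (h : FinRes R N n A f) :
    f ∘ₗ (A 0).mulVecLin = 0 := by
  apply LinearMap.ext
  intro v
  exact (h.ex0 _).2 ⟨v, rfl⟩

open CategoryTheory Limits

noncomputable def FinRes.cx (h : FinRes R N n A f) : ChainComplex (ModuleCat.{0} R) ℕ :=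
  ChainComplex.of (fun i => ModuleCat.of R (Fin (n i) → R))
    (fun i => ModuleCat.ofHom (A i).mulVecLin) (fun i => by
      rw [← ModuleCat.ofHom_comp, ← Matrix.mulVecLin_mul, h.zero, Matrix.mulVecLin_zero]; rfl)

lemma FinRes.cx_d (h : FinRes R N n A f) (i : ℕ) :
    h.cx.d (i+1) i = ModuleCat.ofHom (A i).mulVecLin :=
  ChainComplex.of_d (fun i => ModuleCat.of R (Fin (n i) → R)) (fun i => ModuleCat.ofHom (A i).mulVecLin) i

lemma FinRes.exactAt (h : FinRes R N n A f) (i : ℕ) : h.cx.ExactAt (i+1) := by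
  rw [HomologicalComplex.exactAt_iff' _ (i + 1 + 1) (i + 1) i (by simp) (by simp)]
  rw [ShortComplex.moduleCat_exact_iff]
  intro v hv
  change h.cx.d (i+1) i v = 0 at hv
  change ∃ w, h.cx.d (i+1+1) (i+1) w = v
  rw [h.cx_d] at hv ⊢
  obtain ⟨w, hw⟩ := (h.ex i v).1 hv
  exact ⟨w, hw.symm⟩

noncomputable def FinRes.res (h : FinRes R N n A f) :
    ProjectiveResolution (ModuleCat.of R N) where
  complex := h.cx
  projective i := inferInstanceAs (Projective (ModuleCat.of R (Fin (n i) → R)))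
  π := (ChainComplex.toSingle₀Equiv _ _).symm ⟨ModuleCat.ofHom f, by
    rw [h.cx_d]
    exact (ModuleCat.ofHom_comp _ _).symm.trans (by rw [h.comp_zero]; rfl)⟩
  quasiIso := ⟨fun i => by
    cases i with
    | zero =>
      rw [ChainComplex.quasiIsoAt₀_iff, ShortComplex.quasiIso_iff_of_zeros']
      · constructor
        · rw [ShortComplex.moduleCat_exact_iff]
          intro v hv
          change ∃ w, h.cx.d (0+1) 0 w = v
          rw [h.cx_d]
          obtain ⟨w, hw⟩ := (h.ex0 v).1 hv
          exact ⟨w, hw.symm⟩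
        · rw [ModuleCat.epi_iff_surjective]
          exact h.surj
      all_goals rfl
    | succ i =>
      rw [quasiIsoAt_iff_exactAt']
      · apply h.exactAt
      · apply ChainComplex.exactAt_succ_single_obj⟩

lemma FinRes.dual (h : FinRes R N n A f)
    (hext : ∀ i : ℕ, 1 ≤ i → Subsingleton (((Ext R (ModuleCat R) i).obj
      (Opposite.op (ModuleCat.of R N))).obj (ModuleCat.of R R)))
    (i : ℕ) (v : Fin (n (i+1)) → R) (hv : v ᵥ* A (i+1) = 0) : ∃ w, v = w ᵥ* A i := by
  have h1 := hext (i+1) (by simp)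
  have h2 : IsZero (((Ext R (ModuleCat R) (i+1)).obj
      (Opposite.op (ModuleCat.of R N))).obj (ModuleCat.of R R)) :=
    ModuleCat.isZero_of_subsingleton _
  have h3 := h2.of_iso (h.res.isoExt (R := R) (i+1) (ModuleCat.of R R)).symm
  rw [← HomologicalComplex.exactAt_iff_isZero_homology,
    HomologicalComplex.exactAt_iff' _ i (i + 1) (i + 1 + 1) (by simp) (by simp),
    ShortComplex.moduleCat_exact_iff] at h3
  let φ : h.cx.X (i+1) ⟶ ModuleCat.of R R :=
    ModuleCat.ofHom (X := Fin (n (i+1)) → R) (Y := R) (dotProductBilin R R v)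
  obtain ⟨ψ, hψ⟩ := h3 φ (by
    change h.cx.d (i+1+1) (i+1) ≫ φ = 0
    rw [h.cx_d]
    apply ModuleCat.hom_ext
    apply LinearMap.ext
    have hz : ∀ u, v ⬝ᵥ (A (i+1) *ᵥ u) = 0 := fun u => by
      rw [Matrix.dotProduct_mulVec, hv, zero_dotProduct]
    exact hz)
  change h.cx.d (i+1) i ≫ ψ = φ at hψ
  rw [h.cx_d] at hψ
  let ψ' : (Fin (n i) → R) →ₗ[R] R := ModuleCat.Hom.hom ψ
  have key : ∀ u, ψ' (A i *ᵥ u) = v ⬝ᵥ u := fun u =>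
    LinearMap.congr_fun (congrArg ModuleCat.Hom.hom hψ) u
  refine ⟨fun j => ψ' (Pi.single j 1), ?_⟩
  have key2 : ∀ u, ψ' u = (fun j => ψ' (Pi.single j 1)) ⬝ᵥ u := fun u => by
    conv_lhs => rw [← Finset.univ_sum_single u, map_sum]
    refine Finset.sum_congr rfl fun j _ => ?_
    rw [mul_comm, ← smul_eq_mul, ← map_smul, ← Pi.single_smul', smul_eq_mul, mul_one]
  apply dotProduct_eq
  intro u
  rw [← key, key2, Matrix.dotProduct_mulVec]

lemma FinRes.free [IsLocalRing R] (h : FinRes R N n A f)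
    (hB : ∃ B : Matrix (Fin (n 1)) (Fin (n 0)) R, A 0 * B * A 0 = A 0) : Module.Free R N := by
  obtain ⟨B, hB⟩ := hB
  have hfin : Module.Finite R N := Module.Finite.of_surjective f h.surj
  let g : (Fin (n 0) → R) →ₗ[R] (Fin (n 0) → R) := LinearMap.id - (A 0 * B).mulVecLin
  have hg : ∀ u, g u = u - A 0 *ᵥ (B *ᵥ u) := fun u => by
    rw [Matrix.mulVec_mulVec]; rfl
  have hker : ∀ u u', f u = f u' → g u = g u' := fun u u' huu => by
    obtain ⟨w, hw⟩ := (h.ex0 (u - u')).1 (by rw [map_sub, huu, sub_self])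
    rw [← sub_eq_zero, ← map_sub, hw, hg, Matrix.mulVec_mulVec, Matrix.mulVec_mulVec,
      hB, sub_self]
  have hfg : ∀ u, f (g u) = f u := fun u => by
    rw [hg, map_sub, (h.ex0 _).2 ⟨B *ᵥ u, rfl⟩, sub_zero]
  choose s hs using h.surj
  let t : N →ₗ[R] (Fin (n 0) → R) :=
    { toFun := fun y => g (s y)
      map_add' := fun y z => by rw [← map_add]; apply hker; simp [hs]
      map_smul' := fun c y => by
        rw [← map_smul]; apply hker; simp [hs] }
  have : Module.Projective R N := Module.Projective.of_split t f (by
    apply LinearMap.ext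
    intro y
    change f (g (s y)) = y
    rw [hfg, hs])
  exact Module.free_of_flat_of_isLocalRing
end

/-- Over a regular local ring, a finitely generated module `N` with
`Ext^i(N, O) = 0` for all `i ≥ 1` is free. -/
theorem free_of_ext_vanishing (O : Type) [CommRing O] [IsLocalRing O]
    [IsNoetherianRing O] (hreg : IsRegularLocal O)
    (N : Type) [AddCommGroup N] [Module O N] [Module.Finite O N]
    (hext : ∀ i : ℕ, 1 ≤ i → Subsingleton (((Ext O (ModuleCat O) i).obj
      (Opposite.op (ModuleCat.of O N))).obj (ModuleCat.of O O))) :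
    Module.Free O N := by
  obtain ⟨rs, hr, hm, -⟩ := hreg
  obtain ⟨n, A, f, h⟩ := exists_finRes O N
  exact h.free (main_mat _ O rs rfl hr.toIsWeaklyRegular hm n A
    ⟨h.zero, fun i v => (h.ex i v).1, h.dual hext⟩)
end

section
/- Let O be a regular local ring of Krull dimension at most 2 and let E be a finitely generated reflexive O-module. Then E is a free O-module. -/
open CategoryTheory

open RingTheory.Sequence in
/-- A finite module on which generators of the maximal ideal form a weakly regular
sequence is free. -/
theorem free_of_weaklyRegular_generators (n : ℕ) : ∀ (R : Type) [CommRing R] [IsLocalRing R]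
    [IsNoetherianRing R] (M : Type) [AddCommGroup M] [Module R M] [Module.Finite R M]
    (rs : List R), rs.length = n → Ideal.ofList rs = IsLocalRing.maximalIdeal R →
    IsWeaklyRegular M rs → Module.Free R M := by
  induction n with
  | zero =>
    intro R _ _ _ M _ _ _ rs hl hm _
    obtain rfl := List.length_eq_zero_iff.mp hl
    rw [Ideal.ofList_nil] at hm
    have hf : IsField R := IsLocalRing.isField_iff_maximalIdeal_eq.mpr hm.symm
    let := hf.toField
    exact Module.Free.of_divisionRing R M
  | succ n ih =>
    intro R _ _ _ M _ _ _ rs hl hm hw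
    match rs, hl, hm, hw with
    | r :: rs, hl, hm, hw =>
      rw [isWeaklyRegular_cons_iff'] at hw
      have hr : r ∈ IsLocalRing.maximalIdeal R := by
        rw [← hm]; exact Ideal.subset_span (by simp)
      have hne : Ideal.span {r} ≠ ⊤ := fun h =>
        (IsLocalRing.maximalIdeal.isMaximal R).ne_top
          (top_le_iff.mp (h ▸ (Ideal.span_singleton_le_iff_mem _).mpr hr))
      have : Nontrivial (R ⧸ Ideal.span {r}) := Ideal.Quotient.nontrivial_iff.mpr hne
      have : IsLocalRing (R ⧸ Ideal.span {r}) :=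
        IsLocalRing.of_surjective' (Ideal.Quotient.mk _) Ideal.Quotient.mk_surjective
      have := Module.Finite.of_restrictScalars_finite R (R ⧸ Ideal.span {r}) (QuotSMulTop r M)
      have := Module.finitePresentation_of_finite R M
      refine (Module.free_quotSMulTop_iff_free R M (x := r) ?_ hw.1).mp ?_
      · rwa [IsLocalRing.jacobson_eq_maximalIdeal _ bot_ne_top]
      · refine ih (R ⧸ Ideal.span {r}) (QuotSMulTop r M)
          (rs.map (Ideal.Quotient.mk (Ideal.span {r}))) (by simpa using hl) ?_ hw.2
        have h1 : Ideal.map (Ideal.Quotient.mk (Ideal.span {r})) (IsLocalRing.maximalIdeal R)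
            = IsLocalRing.maximalIdeal (R ⧸ Ideal.span {r}) := by
          have := Ideal.map_eq_top_or_isMaximal_of_surjective
            (Ideal.Quotient.mk (Ideal.span {r})) Ideal.Quotient.mk_surjective
            (IsLocalRing.maximalIdeal.isMaximal R)
          rcases this with h | h
          · exfalso
            have h2 := congrArg (Ideal.comap (Ideal.Quotient.mk (Ideal.span {r}))) h
            rw [Ideal.comap_map_of_surjective _ Ideal.Quotient.mk_surjective,
              ← RingHom.ker_eq_comap_bot, Ideal.mk_ker, Ideal.comap_top,
              sup_eq_left.mpr ((Ideal.span_singleton_le_iff_mem _).mpr hr)] at h2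
            exact (IsLocalRing.maximalIdeal.isMaximal R).ne_top h2
          · exact IsLocalRing.eq_maximalIdeal h
        rw [← h1, ← hm, Ideal.ofList_cons, Ideal.map_sup, Ideal.map_ofList, Ideal.map_quotient_self,
          bot_sup_eq]

/-- A regular element on `R` is regular on any dual module. -/
theorem dual_smulRegular {R D : Type} [CommRing R] [AddCommGroup D] [Module R D] {x : R}
    (hx : IsSMulRegular R x) : IsSMulRegular (Module.Dual R D) x := by
  intro f g h
  ext d
  exact hx (by simpa using LinearMap.congr_fun h d)

/-- A weakly regular sequence of length two on `R` is weakly regular on any dual module. -/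
theorem dual_smulRegular_quot {R D : Type} [CommRing R] [AddCommGroup D] [Module R D] {x y : R}
    (hx : IsSMulRegular R x) (hy : IsSMulRegular (QuotSMulTop x R) y) :
    IsSMulRegular (QuotSMulTop x (Module.Dual R D)) y := by
  rw [isSMulRegular_quotient_iff_mem_of_smul_mem] at hy ⊢
  intro f hf
  obtain ⟨g, -, hg⟩ := (Submodule.mem_smul_pointwise_iff_exists _ _ _).mp hf
  have key : ∀ d, ∃ c, x * c = f d := by
    intro d
    have := hy (f d) ((Submodule.mem_smul_pointwise_iff_exists _ _ _).mpr
      ⟨g d, trivial, by simpa using LinearMap.congr_fun hg d⟩)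
    obtain ⟨c, -, hc⟩ := (Submodule.mem_smul_pointwise_iff_exists _ _ _).mp this
    exact ⟨c, hc⟩
  choose c hc using key
  refine (Submodule.mem_smul_pointwise_iff_exists _ _ _).mpr
    ⟨{ toFun := c, map_add' := fun a b => hx ?_, map_smul' := fun a b => hx ?_ }, trivial, ?_⟩
  · simp only [smul_eq_mul, mul_add, hc, map_add]
  · simp only [smul_eq_mul, hc, map_smul, RingHom.id_apply]
    rw [mul_left_comm, hc]
  · ext d
    exact hc d

/-- Over a regular local ring of Krull dimension at most 2, every finitely
generated reflexive module is free. -/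
theorem reflexive_free_of_dim_le_two (O : Type) [CommRing O] [IsLocalRing O]
    [IsNoetherianRing O] (hreg : IsRegularLocal O) (hdim : ringKrullDim O ≤ 2)
    (E : Type) [AddCommGroup E] [Module O E] [Module.Finite O E]
    [Module.IsReflexive O E] :
    Module.Free O E := by
  obtain ⟨rs, hr, hm, hl⟩ := hreg
  have hlen : rs.length ≤ 2 := by
    rw [← hl] at hdim
    have h2 : ((rs.length : ℕ) : WithBot ℕ∞) ≤ ((2 : ℕ) : WithBot ℕ∞) := hdim
    exact Nat.cast_le.mp h2
  refine free_of_weaklyRegular_generators _ O E rs rfl hm ?_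
  rw [LinearEquiv.isWeaklyRegular_congr (Module.evalEquiv O E)]
  have hw := hr.toIsWeaklyRegular
  match rs, hlen, hw with
  | [], _, _ => exact .nil _ _
  | [x], _, hw =>
    rw [RingTheory.Sequence.isWeaklyRegular_singleton_iff] at hw ⊢
    exact dual_smulRegular hw
  | [x, y], _, hw =>
    rw [RingTheory.Sequence.isWeaklyRegular_cons_iff,
      RingTheory.Sequence.isWeaklyRegular_singleton_iff] at hw ⊢
    exact ⟨dual_smulRegular hw.1, dual_smulRegular_quot hw.1 hw.2⟩
  | _ :: _ :: _ :: _, h, _ => simp at h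
end

section
/- Let A be a commutative ring, let M and N be A-modules, let a ∈ A, and let f₁, f₂ : M → N be A-linear maps such that a·N ⊆ f₁(M), a·N ⊆ f₂(M), and f₁ - f₂ = a·g for some A-linear map g : M → N. Then f₁(M) = f₂(M), i.e., the images of f₁ and f₂ coincide as submodules of N. -/
/-- If two `A`-linear maps `f₁ f₂ : M → N` both have image containing `a • N`
and are congruent modulo `a` (i.e. `f₁ - f₂ = a • g` for some linear map `g`),
then they have the same image. -/
theorem images_eq_of_congr_mod {A : Type*} [CommRing A] {M N : Type*}
    [AddCommGroup M] [Module A M] [AddCommGroup N] [Module A N]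
    (a : A) (f₁ f₂ g : M →ₗ[A] N)
    (h1 : ∀ y : N, a • y ∈ LinearMap.range f₁)
    (h2 : ∀ y : N, a • y ∈ LinearMap.range f₂)
    (hg : f₁ - f₂ = a • g) :
    LinearMap.range f₁ = LinearMap.range f₂ := by
  have key : ∀ x, f₁ x - f₂ x = a • g x := fun x => by
    simpa using LinearMap.congr_fun hg x
  apply le_antisymm
  · rintro _ ⟨x, rfl⟩
    have e : f₁ x = f₂ x + a • g x := by rw [← key x]; abel
    rw [e]
    exact Submodule.add_mem _ ⟨x, rfl⟩ (h2 _)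
  · rintro _ ⟨x, rfl⟩
    have e : f₂ x = f₁ x - a • g x := by rw [← key x]; abel
    rw [e]
    exact Submodule.sub_mem _ ⟨x, rfl⟩ (h1 _)
end

section
/- Fix a prime p, let k be an algebraic closure of 𝔽_p, let W = W(k) be the ring of p-typical Witt vectors of k, and let σ : W → W be the Witt-vector Frobenius. Let (D₁, φ₁) and (D₂, φ₂) be F-crystals over k. Then the set Hom((D₁,φ₁),(D₂,φ₂)) of W-linear maps f : D₁ → D₂ satisfying f ∘ φ₁ = φ₂ ∘ f is a finitely generated ℤ_p-module (where ℤ_p acts through the natural inclusion ℤ_p = W(𝔽_p) ⊆ W, whose image is fixed by σ). -/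
open WittVector

/-- The Witt vectors of an algebraic closure of `𝔽_p`. -/
abbrev Wp (p : ℕ) [Fact p.Prime] : Type :=
  WittVector p (AlgebraicClosure (ZMod p))

/-- The Witt vector Frobenius `σ : W → W`. -/
noncomputable abbrev frobW (p : ℕ) [Fact p.Prime] : Wp p →+* Wp p :=
  WittVector.frobenius

/-- The natural inclusion `ℤ_p = W(𝔽_p) → W(k)`. -/
noncomputable def zpToW (p : ℕ) [Fact p.Prime] : ℤ_[p] →+* Wp p :=
  (WittVector.map (algebraMap (ZMod p) (AlgebraicClosure (ZMod p)))).comp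
    ((WittVector.equiv p).symm : ℤ_[p] →+* WittVector p (ZMod p))

theorem zpToW_fixed (p : ℕ) [Fact p.Prime] (c : ℤ_[p]) : frobW p (zpToW p c) = zpToW p c := by
  ext n
  simp only [frobW, zpToW, RingHom.comp_apply, WittVector.coeff_frobenius_charP,
    WittVector.map_coeff]
  rw [← map_pow, ZMod.pow_card]

theorem exists_zpToW_of_fixed (p : ℕ) [Fact p.Prime] (a : Wp p) (ha : frobW p a = a) :
    ∃ c : ℤ_[p], zpToW p c = a := by
  have h : ∀ n, ∃ b : ZMod p, algebraMap (ZMod p) (AlgebraicClosure (ZMod p)) b = a.coeff n := by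
    intro n
    have h1 : a.coeff n ^ p = a.coeff n := by
      rw [← WittVector.coeff_frobenius_charP]
      exact congrArg (fun z : Wp p => z.coeff n) ha
    have h2 := (Subfield.mem_bot_iff_pow_eq_self (F := AlgebraicClosure (ZMod p)) (p := p)).2 h1
    have h3 : (⊥ : Subfield (AlgebraicClosure (ZMod p))) ≤
      (algebraMap (ZMod p) (AlgebraicClosure (ZMod p))).fieldRange := bot_le
    exact h3 h2
  choose b hb using h
  refine ⟨WittVector.equiv p (WittVector.mk p b), ?_⟩
  ext n
  simp [zpToW, WittVector.map_coeff, hb]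

/-- The group of morphisms between two `F`-crystals over `k = 𝔽̄_p` is a finitely
generated `ℤ_p`-module: there is a finite set of morphisms such that every
morphism is a `ℤ_p`-linear combination of them. -/
theorem homs_of_F_crystals_finitely_generated_over_Zp (p : ℕ) [Fact p.Prime]
    (D₁ D₂ : Type) [AddCommGroup D₁] [Module (Wp p) D₁]
    [Module.Free (Wp p) D₁] [Module.Finite (Wp p) D₁]
    [AddCommGroup D₂] [Module (Wp p) D₂]
    [Module.Free (Wp p) D₂] [Module.Finite (Wp p) D₂]
    (φ₁ : D₁ →ₛₗ[frobW p] D₁) (φ₂ : D₂ →ₛₗ[frobW p] D₂)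
    (hinj₁ : Function.Injective φ₁) (hinj₂ : Function.Injective φ₂)
    (hcok₁ : ∃ n : ℕ, ∀ x : D₁, ∃ y : D₁, φ₁ y = (p : Wp p) ^ n • x)
    (hcok₂ : ∃ n : ℕ, ∀ x : D₂, ∃ y : D₂, φ₂ y = (p : Wp p) ^ n • x) :
    ∃ s : Finset (D₁ →ₗ[Wp p] D₂),
      (∀ f ∈ s, ∀ x : D₁, f (φ₁ x) = φ₂ (f x)) ∧
      ∀ f : D₁ →ₗ[Wp p] D₂, (∀ x : D₁, f (φ₁ x) = φ₂ (f x)) →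
        ∃ c : (D₁ →ₗ[Wp p] D₂) → ℤ_[p],
          f = ∑ g ∈ s, zpToW p (c g) • g := by
  classical
  letI : Module ℤ_[p] (D₁ →ₗ[Wp p] D₂) := Module.compHom _ (zpToW p)
  have hsm : ∀ (c : ℤ_[p]) (f : D₁ →ₗ[Wp p] D₂), c • f = zpToW p c • f := fun _ _ => rfl
  let H : Submodule ℤ_[p] (D₁ →ₗ[Wp p] D₂) :=
    { carrier := {f | ∀ x, f (φ₁ x) = φ₂ (f x)}
      add_mem' := by
        intro f g hf hg x
        simp only [LinearMap.add_apply, map_add]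
        rw [hf x, hg x]
      zero_mem' := by intro x; simp
      smul_mem' := by
        intro c f hf x
        rw [hsm, LinearMap.smul_apply, LinearMap.smul_apply, hf x, LinearMap.map_smulₛₗ,
          zpToW_fixed] }
  have hp0 : (p : Wp p) ≠ 0 := (WittVector.irreducible p).ne_zero
  suffices hfg : H.FG by
    obtain ⟨s, hs⟩ := hfg
    refine ⟨s, fun f hf => ?_, fun f hf => ?_⟩
    · have : f ∈ H := hs ▸ Submodule.subset_span hf
      exact this
    · have : f ∈ Submodule.span ℤ_[p] (s : Set (D₁ →ₗ[Wp p] D₂)) := by rw [hs]; exact hf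
      obtain ⟨c, -, hc⟩ := Submodule.mem_span_finset.1 this
      exact ⟨c, hc.symm⟩
  -- maximal independent family
  obtain ⟨s, hs, hmax⟩ := exists_maximal_linearIndepOn (Wp p) (fun h : H => (h : D₁ →ₗ[Wp p] D₂))
  let e : s → (D₁ →ₗ[Wp p] D₂) := fun i => ((i : H) : D₁ →ₗ[Wp p] D₂)
  have he : LinearIndependent (Wp p) e := hs
  have hfin : Finite s := he.finite
  have := Fintype.ofFinite s
  let E := Submodule.span (Wp p) (Set.range e)
  have hE : ∀ h ∈ H, ∃ m : ℕ, (p : Wp p) ^ m • h ∈ E := by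
    intro h hh
    by_cases hi : (⟨h, hh⟩ : H) ∈ s
    · have h0 : h ∈ E := Submodule.subset_span ⟨⟨_, hi⟩, rfl⟩
      exact ⟨0, by simpa using h0⟩
    · obtain ⟨a, ha, hm⟩ := hmax _ hi
      obtain ⟨m, b, rfl⟩ := WittVector.exists_eq_pow_p_mul' a ha
      refine ⟨m, ?_⟩
      have h1 : (p ^ m * b : Wp p) • h ∈ E := by
        have : (fun h : H => (h : D₁ →ₗ[Wp p] D₂)) '' s = Set.range e := by
          rw [Set.image_eq_range]
        rw [this] at hm
        exact hm
      have h2 := E.smul_mem (↑b⁻¹ : Wp p) h1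
      rwa [smul_smul, mul_comm (_ ^ _), ← mul_assoc, Units.inv_mul, one_mul] at h2
  -- uniform exponent
  obtain ⟨m, hm⟩ : ∃ m : ℕ, ∀ h ∈ H, (p : Wp p) ^ m • h ∈ E := by
    let F : ℕ →o Submodule (Wp p) (D₁ →ₗ[Wp p] D₂) :=
      { toFun := fun m => E.comap (LinearMap.lsmul (Wp p) _ ((p : Wp p) ^ m))
        monotone' := by
          intro i j hij x hx
          obtain ⟨k, rfl⟩ := Nat.exists_eq_add_of_le hij
          simp only [Submodule.mem_comap, LinearMap.lsmul_apply] at hx ⊢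
          rw [add_comm, pow_add, mul_smul]
          exact E.smul_mem _ hx }
    obtain ⟨n, hn⟩ := monotone_stabilizes_iff_noetherian.mpr
      (inferInstance : IsNoetherian (Wp p) (D₁ →ₗ[Wp p] D₂)) F
    refine ⟨n, fun h hh => ?_⟩
    obtain ⟨k, hk⟩ := hE h hh
    have h1 : h ∈ F k := hk
    have h2 : h ∈ F (max n k) := F.monotone (le_max_right _ _) h1
    rw [← hn _ (le_max_left _ _)] at h2
    exact h2
  have key : ∀ h ∈ H, (p : Wp p) ^ m • h ∈ Submodule.span ℤ_[p] (Set.range e) := by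
    intro h hh
    obtain ⟨a, ha⟩ := (Submodule.mem_span_range_iff_exists_fun _).1 (hm h hh)
    have hrel : ∑ i, (a i - frobW p (a i)) • e i = 0 := by
      obtain ⟨n, hn⟩ := hcok₁
      have hz : ∀ y, (∑ i, (a i - frobW p (a i)) • e i) (φ₁ y) = 0 := by
        intro y
        have h1 : (∑ i, a i • e i) (φ₁ y) = φ₂ ((∑ i, a i • e i) y) := by
          rw [ha, LinearMap.smul_apply, LinearMap.smul_apply, hh y, LinearMap.map_smulₛₗ]
          simp
        have h2 : φ₂ ((∑ i, a i • e i) y) = (∑ i, frobW p (a i) • e i) (φ₁ y) := by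
          simp only [LinearMap.sum_apply, LinearMap.smul_apply, map_sum, LinearMap.map_smulₛₗ]
          refine Finset.sum_congr rfl fun i _ => ?_
          rw [i.1.2 y]
        simp only [sub_smul, Finset.sum_sub_distrib, LinearMap.sub_apply]
        rw [h1, h2, sub_self]
      ext x
      obtain ⟨y, hy⟩ := hn x
      have := hz y
      rw [hy, map_smul] at this
      exact (smul_eq_zero.1 this).resolve_left (pow_ne_zero _ hp0)
    have hfix := Fintype.linearIndependent_iff.1 he _ hrel
    rw [← ha]
    refine Submodule.sum_mem _ fun i _ => ?_
    obtain ⟨c, hc⟩ := exists_zpToW_of_fixed p (a i) (sub_eq_zero.1 (hfix i)).symm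
    rw [← hc, ← hsm]
    exact Submodule.smul_mem _ _ (Submodule.subset_span ⟨i, rfl⟩)
  let S := Submodule.span ℤ_[p] (Set.range e)
  have hS : Module.Finite ℤ_[p] S := Module.Finite.span_of_finite _ (Set.finite_range e)
  let L : H →ₗ[ℤ_[p]] S :=
    { toFun := fun h => ⟨(p : Wp p) ^ m • (h : D₁ →ₗ[Wp p] D₂), key h h.2⟩
      map_add' := by intro x y; ext1; simp
      map_smul' := by
        intro c x
        ext1
        simp only [Submodule.coe_smul, hsm, RingHom.id_apply]
        rw [smul_comm] }
  have hL : Function.Injective L := by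
    intro x y hxy
    have h1 : (p : Wp p) ^ m • (x : D₁ →ₗ[Wp p] D₂) = (p : Wp p) ^ m • (y : D₁ →ₗ[Wp p] D₂) :=
      congrArg Subtype.val hxy
    exact Subtype.ext (smul_right_injective _ (pow_ne_zero m hp0) h1)
  have : IsNoetherian ℤ_[p] H := isNoetherian_of_injective L hL
  exact Module.Finite.iff_fg.1 inferInstance
end

section
/- Fix a prime p, let k be an algebraic closure of 𝔽_p, let W = W(k) be the ring of p-typical Witt vectors of k, and let σ : W → W be the Witt-vector Frobenius. Let (D₁, φ₁) and (D₂, φ₂) be F-crystals over k of the same rank, and let N be a fixed non-negative integer. Then the set of W-submodules M ⊆ D₂ such that (i) φ₂(M) ⊆ M, (ii) the quotient D₂/M is killed by p^N (i.e., p^N·D₂ ⊆ M), and (iii) there exists a W-linear bijection g : D₁ → M with g ∘ φ₁ = φ₂ ∘ g, is finite. -/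
open WittVector

/-- A Witt vector fixed by Frobenius is an integer modulo `p`. -/
theorem aux_fixed (p : ℕ) [Fact p.Prime] (b : Wp p) (hb : frobW p b = b) :
    ∃ (c : ℤ) (d : Wp p), b = (c : Wp p) + (p : Wp p) * d := by
  have h0 : (b.coeff 0) ^ p = b.coeff 0 := by
    have := congrArg (fun z : Wp p => z.coeff 0) hb
    simpa [WittVector.coeff_frobenius_charP] using this
  rw [← Subfield.mem_bot_iff_pow_eq_self (AlgebraicClosure (ZMod p)) p,
    _root_.mem_bot_iff_intCast p] at h0
  obtain ⟨c, hc⟩ := h0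
  have h1 : (b - (c : Wp p)).coeff 0 = 0 := by
    change WittVector.constantCoeff (b - (c : Wp p)) = 0
    rw [map_sub, map_intCast, hc]
    exact sub_self _
  by_cases hz : b - (c : Wp p) = 0
  · exact ⟨c, 0, by rw [mul_zero, add_zero]; exact sub_eq_zero.1 hz⟩
  · obtain ⟨m, d, hd, he⟩ := WittVector.exists_eq_pow_p_mul _ hz
    cases m with
    | zero =>
      rw [pow_zero, one_mul] at he
      rw [he] at h1
      exact absurd h1 hd
    | succ m =>
      refine ⟨c, (p : Wp p) ^ m * d, ?_⟩
      rw [← mul_assoc, ← pow_succ', ← he]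
      ring

/-- Families stable under Frobenius that are independent mod `p` over `ℤ` are
independent over `W`. -/
theorem aux_linInd (p : ℕ) [Fact p.Prime] {H ι : Type*} [AddCommGroup H] [Module (Wp p) H]
    [Module.Free (Wp p) H] [Fintype ι] (x : ι → H)
    (hσ : ∀ a : ι → Wp p, ∑ i, a i • x i = 0 → ∑ i, frobW p (a i) • x i = 0)
    (hind : ∀ c : ι → ℤ, (∃ h : H, ∑ i, c i • x i = (p : Wp p) • h) →
      ∀ i, (p : ℤ) ∣ c i) :
    LinearIndependent (Wp p) x := by
  classical
  rw [Fintype.linearIndependent_iff]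
  suffices key : ∀ (n : ℕ) (a : ι → Wp p), (Finset.univ.filter (fun i => a i ≠ 0)).card = n →
      ∑ i, a i • x i = 0 → ∀ i, a i = 0 from fun a ha => key _ a rfl ha
  intro n
  induction n using Nat.strong_induction_on with
  | _ n ih =>
  intro a hn ha
  by_contra! hne
  obtain ⟨i₀, hi₀⟩ := hne
  obtain ⟨j, -, hj⟩ := Finset.exists_min_image Finset.univ
    (fun i => IsDiscreteValuationRing.addVal (Wp p) (a i)) ⟨i₀, Finset.mem_univ _⟩
  have hdvd : ∀ i, a j ∣ a i := fun i =>
    IsDiscreteValuationRing.addVal_le_iff_dvd.1 (hj i (Finset.mem_univ _))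
  have hj0 : a j ≠ 0 := fun h => hi₀ (zero_dvd_iff.1 (h ▸ hdvd i₀))
  choose b hb using hdvd
  have hbj : b j = 1 := by
    have := hb j
    exact mul_left_cancel₀ hj0 (by rw [mul_one]; exact this.symm)
  have hbx : ∑ i, b i • x i = 0 := by
    have : a j • ∑ i, b i • x i = 0 := by
      rw [Finset.smul_sum, ← ha]
      refine Finset.sum_congr rfl fun i _ => ?_
      rw [smul_smul, ← hb]
    exact (smul_eq_zero.1 this).resolve_left hj0
  have hfix : ∀ i, frobW p (b i) - b i = 0 := by
    refine ih _ ?_ (fun i => frobW p (b i) - b i) rfl ?_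
    · rw [← hn]
      apply Finset.card_lt_card
      rw [Finset.ssubset_iff_of_subset]
      · refine ⟨j, by simpa using hj0, ?_⟩
        simp [hbj]
      · intro i
        simp only [Finset.mem_filter, Finset.mem_univ, true_and]
        intro h h'
        apply h
        have : b i = 0 := by
          have h2 := hb i
          rw [h'] at h2
          exact (mul_eq_zero.1 h2.symm).resolve_left hj0
        rw [this, map_zero, sub_zero]
    · simp only [sub_smul, Finset.sum_sub_distrib]
      rw [hσ b hbx, hbx, sub_zero]
  choose c d hcd using fun i => aux_fixed p (b i) (sub_eq_zero.1 (hfix i))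
  have hc := hind c ⟨-∑ i, d i • x i, by
    rw [smul_neg, eq_neg_iff_add_eq_zero, Finset.smul_sum, ← Finset.sum_add_distrib, ← hbx]
    refine Finset.sum_congr rfl fun i _ => ?_
    rw [hcd i, add_smul, mul_smul, Int.cast_smul_eq_zsmul]⟩ j
  obtain ⟨e, he⟩ := hc
  have h1 : (1 : Wp p) = (p : Wp p) * ((e : Wp p) + d j) := by
    rw [← hbj, hcd j, he]; push_cast; ring
  exact (WittVector.irreducible p (k := AlgebraicClosure (ZMod p))).not_isUnit
    (IsUnit.of_mul_eq_one _ h1.symm)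

/-- An `𝔽_p`-vector space of bounded rank is finite. -/
theorem aux_fin_of_rank (p : ℕ) [Fact p.Prime] {V : Type*} [AddCommGroup V] [Module (ZMod p) V]
    {n : ℕ} (h : Module.rank (ZMod p) V ≤ n) : Finite V := by
  have hlt : Module.rank (ZMod p) V < Cardinal.aleph0 :=
    h.trans_lt Cardinal.natCast_lt_aleph0
  have : Module.Finite (ZMod p) V := Module.rank_lt_aleph0_iff.1 hlt
  exact Module.finite_of_finite (ZMod p)

/-- A Frobenius-fixed subgroup of a finite free module has finite image modulo `p`. -/
theorem aux_finite (p : ℕ) [Fact p.Prime] {H : Type} [AddCommGroup H] [Module (Wp p) H]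
    [Module.Free (Wp p) H] [Module.Finite (Wp p) H] (A : AddSubgroup H)
    (hσ : ∀ (ι : Type) [Fintype ι] (x : ι → H), (∀ i, x i ∈ A) →
      ∀ a : ι → Wp p, ∑ i, a i • x i = 0 → ∑ i, frobW p (a i) • x i = 0) :
    ∃ T : Set H, T.Finite ∧ (∀ t ∈ T, t ∈ A) ∧
      ∀ f ∈ A, ∃ t ∈ T, ∃ h : H, f = t + (p : Wp p) • h := by
  classical
  let P : AddSubgroup H :=
    (DistribSMul.toAddMonoidHom H (p : Wp p)).range
  have hP : ∀ y, y ∈ P ↔ ∃ h : H, (p : Wp p) • h = y := fun y => Iff.rfl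
  let B : AddSubgroup A := P.comap A.subtype
  let inst : Module (ZMod p) (A ⧸ B) := QuotientAddGroup.zmodModule (n := p) (H := B) (by
    intro y
    change ((p • y : A) : H) ∈ P
    rw [hP]
    exact ⟨y, by rw [Nat.cast_smul_eq_nsmul]; rfl⟩)
  have hrank : Module.rank (ZMod p) (A ⧸ B) ≤ (Module.finrank (Wp p) H : ℕ) := by
    apply rank_le
    intro s hs
    have hli : LinearIndependent (Wp p) (fun i : s => ((Quotient.out i.1 : A) : H)) := by
      refine aux_linInd p _ (hσ _ _ fun i => (Quotient.out i.1 : A).2) ?_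
      rintro c ⟨h, hh⟩ i
      rw [Fintype.linearIndependent_iff] at hs
      rw [← ZMod.intCast_zmod_eq_zero_iff_dvd]
      refine hs (fun i => (c i : ZMod p)) ?_ i
      have h2 : (QuotientAddGroup.mk (∑ i : s, c i • (Quotient.out i.1 : A)) : A ⧸ B) = 0 := by
        rw [QuotientAddGroup.eq_zero_iff]
        change ((∑ i : s, c i • (Quotient.out i.1 : A) : A) : H) ∈ P
        rw [hP]
        refine ⟨h, ?_⟩
        rw [← hh]
        simp
      rw [← h2, ← QuotientAddGroup.mk'_apply, map_sum]
      refine Finset.sum_congr rfl fun i _ => ?_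
      rw [map_zsmul, QuotientAddGroup.mk'_apply, Int.cast_smul_eq_zsmul]
      congr 1
      exact (QuotientAddGroup.out_eq' i.1).symm
    simpa using hli.fintype_card_le_finrank
  have : Finite (A ⧸ B) := aux_fin_of_rank p hrank
  refine ⟨Set.range (fun q : A ⧸ B => ((Quotient.out q : A) : H)), Set.finite_range _, ?_, ?_⟩
  · rintro _ ⟨q, rfl⟩
    exact (Quotient.out q : A).2
  · intro f hf
    refine ⟨_, ⟨QuotientAddGroup.mk (⟨f, hf⟩ : A), rfl⟩, ?_⟩
    have h1 : (QuotientAddGroup.mk (Quotient.out (QuotientAddGroup.mk (⟨f, hf⟩ : A) : A ⧸ B)) :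
      A ⧸ B) = QuotientAddGroup.mk (⟨f, hf⟩ : A) := QuotientAddGroup.out_eq' _
    rw [QuotientAddGroup.eq] at h1
    obtain ⟨h, hh⟩ := (hP _).1 h1
    refine ⟨h, ?_⟩
    rw [hh]
    simp

/-- Passing from `p` to `p ^ N`. -/
theorem aux_finite_pow (p : ℕ) [Fact p.Prime] {H : Type*} [AddCommGroup H] [Module (Wp p) H]
    (A : AddSubgroup H) (hsat : ∀ h : H, (p : Wp p) • h ∈ A → h ∈ A)
    (hT : ∃ T : Set H, T.Finite ∧ (∀ t ∈ T, t ∈ A) ∧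
      ∀ f ∈ A, ∃ t ∈ T, ∃ h : H, f = t + (p : Wp p) • h) (N : ℕ) :
    ∃ T : Set H, T.Finite ∧
      ∀ f ∈ A, ∃ t ∈ T, ∃ h : H, f = t + (p : Wp p) ^ N • h := by
  obtain ⟨T, hTf, hTA, hTc⟩ := hT
  induction N with
  | zero => exact ⟨{0}, Set.finite_singleton _, fun f _ => ⟨0, rfl, f, by simp⟩⟩
  | succ N ih =>
    obtain ⟨S, hS, hSc⟩ := ih
    refine ⟨Set.image2 (fun t s => t + (p : Wp p) • s) T S, hTf.image2 _ hS, ?_⟩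
    intro f hf
    obtain ⟨t, ht, h, rfl⟩ := hTc f hf
    have hh : h ∈ A := hsat h (by simpa using A.sub_mem hf (hTA t ht))
    obtain ⟨s, hs, h', rfl⟩ := hSc h hh
    refine ⟨_, Set.mem_image2_of_mem ht hs, h', ?_⟩
    rw [smul_add, pow_succ', mul_smul, add_assoc]

/-- Oort's finiteness lemma: given two `F`-crystals `(D₁, φ₁)` and `(D₂, φ₂)` over
`k = 𝔽̄_p` of the same rank and a fixed `N`, there are only finitely many
Frobenius-stable `W`-submodules `M ⊆ D₂` containing `p^N·D₂` that are isomorphic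
to `(D₁, φ₁)` as `F`-crystals. -/
theorem finitely_many_subcrystals (p : ℕ) [Fact p.Prime]
    (D₁ D₂ : Type) [AddCommGroup D₁] [Module (Wp p) D₁]
    [Module.Free (Wp p) D₁] [Module.Finite (Wp p) D₁]
    [AddCommGroup D₂] [Module (Wp p) D₂]
    [Module.Free (Wp p) D₂] [Module.Finite (Wp p) D₂]
    (φ₁ : D₁ →ₛₗ[frobW p] D₁) (φ₂ : D₂ →ₛₗ[frobW p] D₂)
    (hinj₁ : Function.Injective φ₁) (hinj₂ : Function.Injective φ₂)
    (hcok₁ : ∃ n : ℕ, ∀ x : D₁, ∃ y : D₁, φ₁ y = (p : Wp p) ^ n • x)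
    (hcok₂ : ∃ n : ℕ, ∀ x : D₂, ∃ y : D₂, φ₂ y = (p : Wp p) ^ n • x)
    (hrank : Module.finrank (Wp p) D₁ = Module.finrank (Wp p) D₂)
    (N : ℕ) :
    {M : Submodule (Wp p) D₂ |
      (∀ x ∈ M, φ₂ x ∈ M) ∧
      (∀ x : D₂, (p : Wp p) ^ N • x ∈ M) ∧
      (∃ g : D₁ →ₗ[Wp p] D₂, Function.Injective g ∧
        LinearMap.range g = M ∧ ∀ x : D₁, g (φ₁ x) = φ₂ (g x))}.Finite := by
  have hp0 : (p : Wp p) ≠ 0 := (WittVector.irreducible p (k := AlgebraicClosure (ZMod p))).ne_zero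
  let A : AddSubgroup (D₁ →ₗ[Wp p] D₂) :=
    { carrier := {g | ∀ x, g (φ₁ x) = φ₂ (g x)}
      add_mem' := by
        intro f g hf hg x
        simp only [LinearMap.add_apply, map_add]
        rw [hf x, hg x]
      zero_mem' := by intro x; simp
      neg_mem' := by
        intro f hf x
        simp only [LinearMap.neg_apply, map_neg]
        rw [hf x] }
  have hA : ∀ g, g ∈ A ↔ ∀ x, g (φ₁ x) = φ₂ (g x) := fun g => Iff.rfl
  have hsat : ∀ h : D₁ →ₗ[Wp p] D₂, (p : Wp p) • h ∈ A → h ∈ A := by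
    intro h hh x
    have h1 := (hA _).1 hh x
    simp only [LinearMap.smul_apply, LinearMap.map_smulₛₗ, map_natCast] at h1
    exact smul_right_injective D₂ hp0 h1
  have hσ : ∀ (ι : Type) [Fintype ι] (x : ι → (D₁ →ₗ[Wp p] D₂)), (∀ i, x i ∈ A) →
      ∀ a : ι → Wp p, ∑ i, a i • x i = 0 → ∑ i, frobW p (a i) • x i = 0 := by
    intro ι _ f hf a ha
    obtain ⟨n, hn⟩ := hcok₁
    ext x
    obtain ⟨y, hy⟩ := hn x
    have h1 : φ₂ ((∑ i, a i • f i) y) = 0 := by rw [ha]; simp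
    have h2 : (∑ i, frobW p (a i) • f i) (φ₁ y) = 0 := by
      rw [← h1]
      simp only [LinearMap.sum_apply, LinearMap.smul_apply, map_sum, LinearMap.map_smulₛₗ]
      refine Finset.sum_congr rfl fun i _ => ?_
      rw [(hA _).1 (hf i) y]
    rw [hy, map_smul] at h2
    exact (smul_eq_zero.1 h2).resolve_left (pow_ne_zero _ hp0)
  obtain ⟨T, hT, hTc⟩ := aux_finite_pow p A hsat (aux_finite p A hσ) N
  refine (hT.image (fun t => LinearMap.range t ⊔
    LinearMap.range ((p : Wp p) ^ N • (LinearMap.id : D₂ →ₗ[Wp p] D₂)))).subset ?_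
  rintro M ⟨-, hM, g, -, rfl, hg⟩
  obtain ⟨t, ht, h, rfl⟩ := hTc g hg
  refine ⟨t, ht, le_antisymm (sup_le ?_ ?_) ?_⟩
  · rintro _ ⟨x, rfl⟩
    have h1 := Submodule.sub_mem _
      (LinearMap.mem_range_self (t + (p : Wp p) ^ N • h) x) (hM (h x))
    simpa using h1
  · rintro _ ⟨x, rfl⟩
    exact hM x
  · rintro _ ⟨x, rfl⟩
    exact Submodule.add_mem_sup (LinearMap.mem_range_self t x) ⟨h x, rfl⟩
end
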